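/- Let H be a simple graph on a finite vertex set V with |V| = n ≥ 2, let G be the complete graph on V, and let S be the set of edges of G that are not edges of H (the non-edges of H). Then S is a guarding set for G if and only if H has no Hamiltonian path. Equivalently, there exists an acyclic orientation of G in which every edge of S is non-flippable (transitive) if and only if H has a Hamiltonian path. -/

import Mathlib

/-- An orientation of a simple graph `G`: a choice, for each edge, of exactly one
of its two directions. -/
structure GraphOrientation {V : Type*} (G : SimpleGraph V) where
  /-- `dir u v` means the edge `uv` is oriented from `u` to `v`. -/
  dir : V → V → Prop
  dir_adj : ∀ u v, dir u v → G.Adj u v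
  dir_total : ∀ u v, G.Adj u v → dir u v ∨ dir v u
  dir_asymm : ∀ u v, dir u v → ¬ dir v u

/-- An orientation is acyclic if it has no directed cycle. -/
def GraphOrientation.IsAcyclic {V : Type*} {G : SimpleGraph V} (O : GraphOrientation G) : Prop :=
  ∀ v, ¬ Relation.TransGen O.dir v v

/-- The directed-edge relation obtained from `O` by reversing the edge directed
from `u` to `v`. -/
def GraphOrientation.flip {V : Type*} {G : SimpleGraph V} (O : GraphOrientation G)
    (u v : V) : V → V → Prop :=
  fun a b => (O.dir a b ∧ ¬(a = u ∧ b = v)) ∨ (a = v ∧ b = u)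

/-- The edge directed from `u` to `v` is flippable if reversing it again yields
an acyclic orientation. -/
def GraphOrientation.Flippable {V : Type*} {G : SimpleGraph V} (O : GraphOrientation G)
    (u v : V) : Prop :=
  O.dir u v ∧ ∀ w, ¬ Relation.TransGen (O.flip u v) w w

/-- A set `S` of edges of `G` is a guarding set if every acyclic orientation of `G`
has a flippable edge belonging to `S`. -/
def SimpleGraph.IsGuarding {V : Type*} (G : SimpleGraph V) (S : Set (Sym2 V)) : Prop :=
  ∀ O : GraphOrientation G, O.IsAcyclic → ∃ u v, O.Flippable u v ∧ s(u, v) ∈ S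

namespace GraphOrientation

variable {V : Type*} {O : GraphOrientation (⊤ : SimpleGraph V)}

/-- An acyclic orientation of a complete graph is a transitive relation. -/
theorem IsAcyclic.dir_trans (hO : O.IsAcyclic) {a b c : V} (hab : O.dir a b)
    (hbc : O.dir b c) : O.dir a c := by
  have hac : a ≠ c := by
    rintro rfl
    exact O.dir_asymm a b hab hbc
  refine (O.dir_total a c hac).resolve_right fun hca => hO a ?_
  exact ((Relation.TransGen.single hab).tail hbc).tail hca

/-- In an acyclic orientation of a complete graph, the flippable edges are exactly the
covering pairs of the associated linear order. -/
theorem IsAcyclic.flippable_iff (hO : O.IsAcyclic) {u v : V} :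
    O.Flippable u v ↔ O.dir u v ∧ ∀ w, O.dir u w → ¬ O.dir w v := by
  refine and_congr_right fun huv => ⟨fun h w huw hwv => h u ?_, fun h w hw => ?_⟩
  · have hwv' : w ≠ v := (O.dir_adj w v hwv).ne
    have hwu : w ≠ u := (O.dir_adj u w huw).ne'
    have h₁ : O.flip u v u w := .inl ⟨huw, fun h => hwv' h.2⟩
    have h₂ : O.flip u v w v := .inl ⟨hwv, fun h => hwu h.1⟩
    exact ((Relation.TransGen.single h₁).tail h₂).tail (.inr ⟨rfl, rfl⟩)
  · have htot {a b : V} (hab : a ≠ b) (hn : ¬ O.dir b a) : O.dir a b :=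
      (O.dir_total a b hab).resolve_right hn
    have : IsTrans V (O.flip u v) := by
      refine ⟨fun a b c => ?_⟩
      rintro (⟨hab, hab'⟩ | ⟨rfl, rfl⟩) (⟨hbc, hbc'⟩ | ⟨rfl, rfl⟩)
      · refine .inl ⟨hO.dir_trans hab hbc, ?_⟩
        rintro ⟨rfl, rfl⟩
        exact h b hab hbc
      · have hac : a ≠ c := fun e => hab' ⟨e, rfl⟩
        refine .inl ⟨htot hac fun hca => h a hca hab, fun e => hac e.1⟩
      · have hac : a ≠ c := fun e => hbc' ⟨rfl, e.symm⟩
        refine .inl ⟨htot hac fun hca => h c hbc hca, fun e => hac e.2.symm⟩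
      · exact absurd rfl (O.dir_adj _ _ huv).ne
    rw [Relation.transGen_eq_self] at hw
    rcases hw with ⟨hw, -⟩ | ⟨rfl, rfl⟩
    · exact (O.dir_adj w w hw).ne rfl
    · exact (O.dir_adj _ _ huv).ne rfl

/-- An acyclic orientation of a finite complete graph lists the vertices in linear order. -/
theorem IsAcyclic.exists_list [Fintype V] (hO : O.IsAcyclic) :
    ∃ l : List V, l.Pairwise O.dir ∧ l.Nodup ∧ ∀ v, v ∈ l := by
  classical
  let r : V → V → Prop := fun a b => a = b ∨ O.dir a b
  have : IsTrans V r := ⟨by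
    rintro a b c (rfl | hab) (rfl | hbc)
    exacts [.inl rfl, .inr hbc, .inr hab, .inr (hO.dir_trans hab hbc)]⟩
  have : Std.Antisymm r := ⟨by
    rintro a b (rfl | hab) (hba | hba)
    exacts [rfl, rfl, hba.symm, absurd hba (O.dir_asymm a b hab)]⟩
  have : Std.Total r := ⟨fun a b => by
    by_cases hab : a = b
    · exact .inl (.inl hab)
    · exact (O.dir_total a b hab).imp .inr .inr⟩
  refine ⟨Finset.univ.sort r, ?_, Finset.univ.sort_nodup r, by simp⟩
  exact ((Finset.univ.pairwise_sort r).and (Finset.univ.sort_nodup r)).imp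
    fun h => h.1.resolve_left h.2

/-- Consecutive vertices of a list sorted along an acyclic orientation of a complete graph
span flippable edges. -/
theorem IsAcyclic.isChain_flippable (hO : O.IsAcyclic) {l : List V} (hl : l.Pairwise O.dir)
    (hmem : ∀ v, v ∈ l) : l.IsChain O.Flippable := by
  rw [List.isChain_iff_getElem]
  rw [List.pairwise_iff_getElem] at hl
  intro i hi
  refine hO.flippable_iff.2 ⟨hl _ _ _ _ i.lt_succ_self, fun w h₁ h₂ => ?_⟩
  obtain ⟨k, hk, rfl⟩ := List.getElem_of_mem (hmem w)
  rcases lt_trichotomy k i with hki | rfl | hki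
  · exact O.dir_asymm _ _ h₁ (hl _ _ _ _ hki)
  · exact (O.dir_adj _ _ h₁).ne rfl
  · rcases (Nat.succ_le_of_lt hki).eq_or_lt with rfl | hki
    · exact (O.dir_adj _ _ h₂).ne rfl
    · exact O.dir_asymm _ _ h₂ (hl _ _ _ _ hki)

/-- The orientation of the complete graph along an injective ranking of its vertices. -/
def ofInjective (f : V → ℕ) (hf : Function.Injective f) :
    GraphOrientation (⊤ : SimpleGraph V) where
  dir a b := f a < f b
  dir_adj a b h := by
    rw [SimpleGraph.top_adj]
    rintro rfl
    exact lt_irrefl _ h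
  dir_total a b h := lt_or_gt_of_ne (hf.ne h)
  dir_asymm _ _ h := lt_asymm h

theorem isAcyclic_ofInjective (f : V → ℕ) (hf : Function.Injective f) :
    (ofInjective f hf).IsAcyclic := by
  have : IsTrans V (ofInjective f hf).dir := ⟨fun _ _ _ => lt_trans⟩
  intro v hv
  rw [Relation.transGen_eq_self] at hv
  exact lt_irrefl _ hv

end GraphOrientation

/-- Let `H` be a simple graph on a finite vertex set with at least two vertices, let
`G = ⊤` be the complete graph on the same vertex set, and let `S` be the set of edges of
`G` that are not edges of `H`. Then `S` is a guarding set for `G` if and only if `H` has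
no Hamiltonian path. -/
theorem nonEdges_guarding_iff_no_hamiltonian_path {V : Type*} [Fintype V] [DecidableEq V]
    (hV : 2 ≤ Fintype.card V) (H : SimpleGraph V) :
    (⊤ : SimpleGraph V).IsGuarding
        {e | e ∈ (⊤ : SimpleGraph V).edgeSet ∧ e ∉ H.edgeSet} ↔
      ¬ ∃ (u v : V) (p : H.Walk u v), p.IsHamiltonian := by
  rw [← not_iff_not, not_not]
  constructor
  · intro h
    simp only [SimpleGraph.IsGuarding, not_forall, not_exists, not_and] at h
    obtain ⟨O, hO, hS⟩ := h
    obtain ⟨l, hl, hnodup, hmem⟩ := hO.exists_list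
    have hne : l ≠ [] := by
      obtain ⟨v⟩ : Nonempty V := Fintype.card_pos_iff.1 (by omega)
      exact List.ne_nil_of_mem (hmem v)
    have hchain : l.IsChain H.Adj := by
      refine (hO.isChain_flippable hl hmem).imp fun a b hab => ?_
      by_contra hH
      exact hS a b hab ⟨O.dir_adj a b hab.1, hH⟩
    refine ⟨_, _, .ofSupport l hne hchain, fun a => ?_⟩
    rw [SimpleGraph.Walk.support_ofSupport]
    exact List.count_eq_one_of_mem hnodup (hmem a)
  · rintro ⟨u, v, p, hp⟩ hG
    have hf : Function.Injective (p.support.idxOf ·) := fun a b hab =>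
      (List.idxOf_inj (hp.mem_support a)).1 hab
    have hO := GraphOrientation.isAcyclic_ofInjective _ hf
    obtain ⟨a, b, hab, -, hH⟩ := hG _ hO
    obtain ⟨hlt, hcov⟩ := hO.flippable_iff.1 hab
    change p.support.idxOf a < p.support.idxOf b at hlt
    have hb := List.idxOf_lt_length_of_mem (hp.mem_support b)
    have hsucc : p.support.idxOf b = p.support.idxOf a + 1 := by
      by_contra hne
      have hk : p.support.idxOf a + 1 < p.support.length := by omega
      have hidx := hp.isPath.support_nodup.idxOf_getElem _ hk
      refine hcov p.support[p.support.idxOf a + 1] ?_ ?_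
      · change p.support.idxOf a < p.support.idxOf _
        omega
      · change p.support.idxOf _ < p.support.idxOf b
        omega
    have hadj := List.isChain_iff_getElem.1 p.isChain_adj_support (p.support.idxOf a)
      (hsucc ▸ hb)
    simp only [← hsucc, List.getElem_idxOf] at hadj
    exact hH hadj
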